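/- Let 0 < ε < 1/14 and 0 < δ < 1, and let A, B be real d×n matrices all of whose columns are nonzero. There exists an absolute constant C > 0 such that if k ≥ C·log(2n/δ)/ε², then with probability at least 1−δ over the random sketching matrix Π (a k×d matrix with i.i.d. N(0,1/k) entries): all sketched columns Ã_i = ΠA_i and B̃_j = ΠB_j are nonzero, and for all (i,j) ∈ [n]×[n] the rescaled-JL estimator satisfies |M̃(i,j) − A_i^T B_j| ≤ ε·‖A_i‖·‖B_j‖, and moreover ‖M̃ − A^T B‖_F ≤ ε·‖A‖_F·‖B‖_F. -/

import Mathlib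

open MeasureTheory ProbabilityTheory Matrix
open scoped NNReal ENNReal

noncomputable def cnorm {d n : ℕ} (A : Matrix (Fin d) (Fin n) ℝ) (i : Fin n) : ℝ :=
  Real.sqrt (∑ r, (A r i) ^ 2)

noncomputable def frobNorm {d n : ℕ} (A : Matrix (Fin d) (Fin n) ℝ) : ℝ :=
  Real.sqrt (∑ r, ∑ i, (A r i) ^ 2)

noncomputable def specNorm {m n : ℕ} (A : Matrix (Fin m) (Fin n) ℝ) : ℝ :=
  ‖LinearMap.toContinuousLinearMap (Matrix.toEuclideanLin A)‖

/-- The distribution of a k×d random matrix with i.i.d. N(0, 1/k) entries. -/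
noncomputable def gaussianMatrix (k d : ℕ) : Measure (Fin k → Fin d → ℝ) :=
  Measure.pi fun _ : Fin k => Measure.pi fun _ : Fin d => gaussianReal 0 (k : ℝ≥0)⁻¹

/-- The rescaled-JL estimator M̃(i,j) = ‖A_i‖·‖B_j‖·(Ã_i^T B̃_j)/(‖Ã_i‖·‖B̃_j‖),
where Ã = ΠA and B̃ = ΠB. -/
noncomputable def rescaledJL {k d n : ℕ} (P : Fin k → Fin d → ℝ)
    (A B : Matrix (Fin d) (Fin n) ℝ) : Matrix (Fin n) (Fin n) ℝ :=
  Matrix.of fun i j =>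
    cnorm A i * cnorm B j * (((Matrix.of P * A)ᵀ * (Matrix.of P * B)) i j) /
      (cnorm (Matrix.of P * A) i * cnorm (Matrix.of P * B) j)


lemma map_sum_mul_pi_gaussianReal {d : ℕ} (v : ℝ≥0) (w : Fin d → ℝ) :
    (Measure.pi fun _ : Fin d => gaussianReal 0 v).map (fun g => ∑ r, g r * w r) =
      gaussianReal 0 (v * ∑ r, ‖w r‖₊ ^ 2) := by
  have hm : Measurable fun g : Fin d → ℝ => ∑ r, g r * w r := by fun_prop
  have : IsProbabilityMeasure
      ((Measure.pi fun _ : Fin d => gaussianReal 0 v).map fun g => ∑ r, g r * w r) :=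
    Measure.isProbabilityMeasure_map hm.aemeasurable
  refine Measure.ext_of_charFun ?_
  ext s
  rw [charFun_apply_real, integral_map hm.aemeasurable (by fun_prop)]
  have h (g : Fin d → ℝ) : Complex.exp (s * (∑ r, g r * w r : ℝ) * Complex.I) =
      ∏ r, Complex.exp ((s * w r : ℝ) * (g r) * Complex.I) := by
    rw [← Complex.exp_sum]
    congr 1
    push_cast
    rw [Finset.mul_sum, Finset.sum_mul]
    exact Finset.sum_congr rfl fun r _ => by ring
  simp_rw [h]
  rw [integral_fintype_prod_eq_prod
    (f := fun r (x : ℝ) => Complex.exp ((s * w r : ℝ) * x * Complex.I))]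
  simp_rw [← charFun_apply_real, charFun_gaussianReal]
  rw [← Complex.exp_sum]
  congr 1
  have hw (r : Fin d) : ((‖w r‖₊ : ℝ) : ℂ) ^ 2 = (w r : ℂ) ^ 2 := by
    norm_cast
    simp
  push_cast
  simp only [coe_nnnorm] at hw
  simp_rw [hw]
  simp only [mul_zero, zero_mul, zero_sub, Finset.mul_sum, Finset.sum_mul, Finset.sum_div,
    ← Finset.sum_neg_distrib]
  exact Finset.sum_congr rfl fun r _ => by ring

lemma mgf_sq_gaussianReal {v : ℝ≥0} (hv : v ≠ 0) {t : ℝ} (ht : 2 * (t * v) < 1) :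
    mgf (fun x => x ^ 2) (gaussianReal 0 v) t = (√(1 - 2 * (t * v)))⁻¹ := by
  have hv' : (0 : ℝ) < v := by positivity
  have hpos : 0 < 1 - 2 * (t * v) := by linarith
  rw [mgf, integral_gaussianReal_eq_integral_smul hv]
  have h (x : ℝ) : gaussianPDFReal 0 v x • Real.exp (t * x ^ 2) =
      (√(2 * Real.pi * v))⁻¹ * Real.exp (-((1 - 2 * (t * v)) / (2 * v)) * x ^ 2) := by
    rw [gaussianPDFReal, smul_eq_mul, mul_assoc, ← Real.exp_add]
    congr 2
    field_simp
    ring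
  simp_rw [h]
  rw [integral_const_mul, integral_gaussian, ← Real.sqrt_inv, ← Real.sqrt_inv,
    ← Real.sqrt_mul (by positivity)]
  congr 1
  have := Real.pi_pos
  field_simp

lemma inv_sqrt_one_sub_two_mul_le {τ : ℝ} (hτ : |τ| ≤ 1 / 4) :
    (√(1 - 2 * τ))⁻¹ ≤ Real.exp (τ + 4 * τ ^ 2) := by
  have hb := abs_le.1 hτ
  have hpos : 0 < 1 - 2 * τ := by linarith
  have hy : |2 * τ| ≤ 1 / 2 := by
    rw [abs_mul, abs_two]
    linarith
  have h := Real.abs_log_sub_add_sum_range_le (x := 2 * τ) (by linarith) 1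
  simp only [Finset.sum_range_one, zero_add, pow_one, Nat.cast_zero, div_one, sq_abs,
    Nat.reduceAdd] at h
  have h2 : (2 * τ) ^ 2 / (1 - |2 * τ|) ≤ 8 * τ ^ 2 := by
    rw [div_le_iff₀ (by linarith)]
    nlinarith [sq_nonneg τ]
  have h3 := (abs_le.1 (h.trans h2)).1
  rw [← Real.sqrt_inv, Real.sqrt_le_left (Real.exp_pos _).le, ← Real.exp_nat_mul,
    ← Real.exp_log hpos, ← Real.exp_neg, Real.exp_le_exp]
  push_cast
  linarith

instance (k d : ℕ) : IsProbabilityMeasure (gaussianMatrix k d) := by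
  unfold gaussianMatrix
  infer_instance

lemma iIndepFun_row_sq (k : ℕ) {d : ℕ} (w : Fin d → ℝ) :
    iIndepFun (fun (i : Fin k) (P : Fin k → Fin d → ℝ) => (∑ r, P i r * w r) ^ 2)
      (gaussianMatrix k d) :=
  iIndepFun_pi (X := fun (_ : Fin k) (g : Fin d → ℝ) => (∑ r, g r * w r) ^ 2)
    fun _ => (by fun_prop : Measurable _).aemeasurable

lemma mgf_row_sq {k d : ℕ} (i : Fin k) (w : Fin d → ℝ) (t : ℝ) :
    mgf (fun P : Fin k → Fin d → ℝ => (∑ r, P i r * w r) ^ 2) (gaussianMatrix k d) t =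
      mgf (fun x => x ^ 2) (gaussianReal 0 ((k : ℝ≥0)⁻¹ * ∑ r, ‖w r‖₊ ^ 2)) t := by
  have hm : AEMeasurable (fun g : Fin d → ℝ => ∑ r, g r * w r)
      (Measure.pi fun _ : Fin d => gaussianReal 0 (k : ℝ≥0)⁻¹) :=
    (by fun_prop : Measurable _).aemeasurable
  have he := (measurePreserving_eval
    (fun _ : Fin k => Measure.pi fun _ : Fin d => gaussianReal 0 (k : ℝ≥0)⁻¹) i).map_eq
  rw [← map_sum_mul_pi_gaussianReal, mgf_map hm (by fun_prop), ← he]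
  exact (mgf_map (Y := fun P : Fin k → Fin d → ℝ => P i)
    (X := fun g : Fin d → ℝ => (∑ r, g r * w r) ^ 2) (measurable_pi_apply i).aemeasurable
    (by fun_prop : Measurable _).aestronglyMeasurable).symm

/-- The squared norm of `P w`. -/
def sketchSq {k d : ℕ} (P : Fin k → Fin d → ℝ) (w : Fin d → ℝ) : ℝ :=
  ∑ i, (∑ r, P i r * w r) ^ 2

lemma mgf_sketchSq_le {k d : ℕ} (hk : 0 < k) {w : Fin d → ℝ} (hw : 0 < ∑ r, w r ^ 2)
    {τ : ℝ} (hτ : |τ| ≤ 1 / 4) :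
    Integrable (fun P => Real.exp (k * τ / (∑ r, w r ^ 2) * sketchSq P w))
      (gaussianMatrix k d) ∧
    mgf (fun P => sketchSq P w) (gaussianMatrix k d) (k * τ / ∑ r, w r ^ 2) ≤
      Real.exp (k * (τ + 4 * τ ^ 2)) := by
  set W := ∑ r, w r ^ 2 with hW
  set v : ℝ≥0 := (k : ℝ≥0)⁻¹ * ∑ r, ‖w r‖₊ ^ 2 with hv
  have hvW : (v : ℝ) = W / k := by
    rw [hv, hW]
    push_cast
    simp [div_eq_inv_mul]
  have hk' : (0 : ℝ) < k := by exact_mod_cast hk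
  have hv0 : v ≠ 0 := by
    rw [← NNReal.coe_ne_zero, hvW]
    positivity
  have htv : k * τ / W * v = τ := by
    rw [hvW]
    field_simp
  have h1 : 2 * (k * τ / W * v) < 1 := by
    rw [htv]
    linarith [(abs_le.1 hτ).2]
  have hfun : (fun P : Fin k → Fin d → ℝ => sketchSq P w) =
      ∑ i, fun P : Fin k → Fin d → ℝ => (∑ r, P i r * w r) ^ 2 := by
    ext P
    simp [sketchSq]
  have hmgf : mgf (fun P => sketchSq P w) (gaussianMatrix k d) (k * τ / W) =
      (√(1 - 2 * τ))⁻¹ ^ k := by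
    rw [hfun, (iIndepFun_row_sq k w).mgf_sum fun i => by fun_prop]
    simp_rw [mgf_row_sq]
    rw [← hv, mgf_sq_gaussianReal hv0 h1, htv]
    simp
  constructor
  · rw [← mgf_pos_iff, hmgf]
    have : 0 < 1 - 2 * τ := by linarith [(abs_le.1 hτ).2]
    positivity
  · rw [hmgf, Real.exp_nat_mul]
    gcongr
    exact inv_sqrt_one_sub_two_mul_le hτ

/-- Concentration of the squared norm of a Gaussian sketch of a fixed vector. -/
lemma gaussianMatrix_sketchSq_deviation_le {k d : ℕ} (hk : 0 < k) (w : Fin d → ℝ) {η : ℝ}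
    (hη : 0 < η) (hη1 : η ≤ 1) :
    (gaussianMatrix k d).real {P | η * ∑ r, w r ^ 2 < |sketchSq P w - ∑ r, w r ^ 2|} ≤
      2 * Real.exp (-(k * η ^ 2 / 16)) := by
  rcases (Finset.sum_nonneg fun r (_ : r ∈ Finset.univ) => sq_nonneg (w r)).eq_or_lt with hW | hW
  · have hw (r : Fin d) : w r = 0 := by
      simpa using (Finset.sum_eq_zero_iff_of_nonneg fun r _ => sq_nonneg (w r)).1 hW.symm r
        (Finset.mem_univ r)
    simp only [sketchSq, hw]
    simp
    positivity
  set W := ∑ r, w r ^ 2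
  have hτ : |η / 8| ≤ 1 / 4 := by
    rw [abs_of_pos (by positivity)]
    linarith
  obtain ⟨hi, hle⟩ := mgf_sketchSq_le hk hW hτ
  obtain ⟨hi', hle'⟩ := mgf_sketchSq_le (τ := -(η / 8)) hk hW (by rwa [abs_neg])
  have hup := (measure_ge_le_exp_mul_mgf (W * (1 + η)) (by positivity) hi).trans
    (mul_le_mul_of_nonneg_left hle (Real.exp_pos _).le)
  have hlow := (measure_le_le_exp_mul_mgf (W * (1 - η))
    (div_nonpos_of_nonpos_of_nonneg (by nlinarith [(Nat.cast_nonneg k : (0 : ℝ) ≤ k)]) hW.le)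
    hi').trans (mul_le_mul_of_nonneg_left hle' (Real.exp_pos _).le)
  rw [← Real.exp_add] at hup hlow
  have e1 : -(k * (η / 8) / W) * (W * (1 + η)) + k * (η / 8 + 4 * (η / 8) ^ 2) =
      -(k * η ^ 2 / 16) := by
    field_simp
    ring
  have e2 : -(k * (-(η / 8)) / W) * (W * (1 - η)) + k * (-(η / 8) + 4 * (-(η / 8)) ^ 2) =
      -(k * η ^ 2 / 16) := by
    field_simp
    ring
  rw [e1] at hup
  rw [e2] at hlow
  have hsub : {P : Fin k → Fin d → ℝ | η * W < |sketchSq P w - W|} ⊆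
      {P | W * (1 + η) ≤ sketchSq P w} ∪ {P | sketchSq P w ≤ W * (1 - η)} := by
    intro P hP
    rcases lt_abs.1 (Set.mem_ofPred_eq ▸ hP) with h | h
    · exact Or.inl (by simp only [Set.mem_ofPred_eq]; linarith)
    · exact Or.inr (by simp only [Set.mem_ofPred_eq]; linarith)
  linarith [(measureReal_mono hsub).trans (measureReal_union_le (μ := gaussianMatrix k d) _ _)]

lemma gaussianMatrix_exists_deviation_le {ι : Type*} [Fintype ι] {k d : ℕ} (hk : 0 < k)
    (w : ι → Fin d → ℝ) {η : ℝ} (hη : 0 < η) (hη1 : η ≤ 1) :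
    (gaussianMatrix k d).real
        {P | ∃ a, η * ∑ r, w a r ^ 2 < |sketchSq P (w a) - ∑ r, w a r ^ 2|} ≤
      Fintype.card ι * (2 * Real.exp (-(k * η ^ 2 / 16))) := by
  rw [Set.ofPred_exists]
  refine (measureReal_iUnion_fintype_le _).trans ?_
  refine (Finset.sum_le_sum fun a _ =>
    gaussianMatrix_sketchSq_deviation_le hk (w a) hη hη1).trans_eq ?_
  simp

lemma sum_sq_linear_combination {ι : Type*} [Fintype ι] (x y : ℝ) (p q : ι → ℝ) :
    ∑ i, (x * p i + y * q i) ^ 2 =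
      x ^ 2 * ∑ i, p i ^ 2 + 2 * x * y * ∑ i, p i * q i + y ^ 2 * ∑ i, q i ^ 2 := by
  simp_rw [Finset.mul_sum, ← Finset.sum_add_distrib]
  exact Finset.sum_congr rfl fun i _ => by ring

lemma sketchSq_linear_combination {k d : ℕ} (P : Fin k → Fin d → ℝ) (x y : ℝ)
    (u v : Fin d → ℝ) :
    sketchSq P (fun r => x * u r + y * v r) =
      x ^ 2 * sketchSq P u + 2 * x * y * ∑ i, (∑ r, P i r * u r) * (∑ r, P i r * v r) +
        y ^ 2 * sketchSq P v := by
  rw [sketchSq, sketchSq, sketchSq, ← sum_sq_linear_combination]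
  refine Finset.sum_congr rfl fun i _ => ?_
  rw [Finset.mul_sum, Finset.mul_sum, ← Finset.sum_add_distrib]
  congr 1
  exact Finset.sum_congr rfl fun r _ => by ring

lemma cnorm_sq {d n : ℕ} (A : Matrix (Fin d) (Fin n) ℝ) (i : Fin n) :
    cnorm A i ^ 2 = ∑ r, A r i ^ 2 :=
  Real.sq_sqrt (Finset.sum_nonneg fun _ _ => sq_nonneg _)

lemma cnorm_nonneg {d n : ℕ} (A : Matrix (Fin d) (Fin n) ℝ) (i : Fin n) : 0 ≤ cnorm A i :=
  Real.sqrt_nonneg _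

lemma cnorm_pos_iff {d n : ℕ} {A : Matrix (Fin d) (Fin n) ℝ} {i : Fin n} :
    0 < cnorm A i ↔ (fun r => A r i) ≠ (0 : Fin d → ℝ) := by
  rw [(cnorm_nonneg A i).lt_iff_ne']
  refine not_congr ?_
  rw [← sq_eq_zero_iff, cnorm_sq, Finset.sum_eq_zero_iff_of_nonneg fun _ _ => sq_nonneg _]
  simp [funext_iff]

lemma cnorm_of_mul_sq {k d n : ℕ} (P : Fin k → Fin d → ℝ) (A : Matrix (Fin d) (Fin n) ℝ)
    (i : Fin n) : cnorm (Matrix.of P * A) i ^ 2 = sketchSq P (fun r => A r i) := by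
  simp [cnorm_sq, sketchSq, Matrix.mul_apply]

lemma abs_transpose_mul_apply_le {d n : ℕ} (A B : Matrix (Fin d) (Fin n) ℝ) (i j : Fin n) :
    |(Aᵀ * B) i j| ≤ cnorm A i * cnorm B j := by
  refine (sq_le_sq.1 ?_).trans_eq
    (abs_of_nonneg (mul_nonneg (cnorm_nonneg A i) (cnorm_nonneg B j)))
  rw [mul_pow, cnorm_sq, cnorm_sq]
  exact Finset.sum_mul_sq_le_sq_mul_sq Finset.univ (fun r => A r i) (fun r => B r j)

lemma frobNorm_sq {d n : ℕ} (A : Matrix (Fin d) (Fin n) ℝ) :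
    frobNorm A ^ 2 = ∑ i, cnorm A i ^ 2 := by
  simp_rw [cnorm_sq]
  exact (Real.sq_sqrt (Finset.sum_nonneg fun _ _ => Finset.sum_nonneg fun _ _ =>
    sq_nonneg _)).trans Finset.sum_comm

lemma frobNorm_le_of_entrywise {d n : ℕ} {A B : Matrix (Fin d) (Fin n) ℝ}
    {E : Matrix (Fin n) (Fin n) ℝ} {ε : ℝ} (hε : 0 ≤ ε)
    (h : ∀ i j, |E i j| ≤ ε * cnorm A i * cnorm B j) :
    frobNorm E ≤ ε * frobNorm A * frobNorm B := by
  have hA : 0 ≤ frobNorm A := Real.sqrt_nonneg _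
  have hB : 0 ≤ frobNorm B := Real.sqrt_nonneg _
  refine (Real.sqrt_le_left (by positivity)).2 ?_
  rw [mul_pow, mul_pow, frobNorm_sq, frobNorm_sq, mul_assoc, Finset.sum_mul_sum, Finset.mul_sum]
  refine Finset.sum_le_sum fun i _ => ?_
  rw [Finset.mul_sum]
  refine Finset.sum_le_sum fun j _ => ?_
  rw [← mul_assoc, ← mul_pow, ← mul_pow, ← sq_abs (E i j)]
  exact pow_le_pow_left₀ (abs_nonneg _) (h i j) 2

lemma abs_rescaled_sub_le {a b p q x t η : ℝ} (ha : 0 < a) (hb : 0 < b) (hp : 0 ≤ p) (hq : 0 ≤ q)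
    (hη : 0 < η) (hη2 : η ≤ 1 / 2) (hpa : |p ^ 2 - a ^ 2| ≤ η * a ^ 2)
    (hqb : |q ^ 2 - b ^ 2| ≤ η * b ^ 2) (hx : |x - t| ≤ η * (a * b)) (ht : |t| ≤ a * b) :
    |a * b * x / (p * q) - t| ≤ 4 * η * a * b := by
  have hab : 0 < a * b := mul_pos ha hb
  rw [abs_le] at hpa hqb
  have hlow : a * b * (1 - η) ≤ p * q := by
    refine le_of_sq_le_sq ?_ (mul_nonneg hp hq)
    calc (a * b * (1 - η)) ^ 2 = (a ^ 2 * (1 - η)) * (b ^ 2 * (1 - η)) := by ring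
      _ ≤ p ^ 2 * q ^ 2 :=
        mul_le_mul (by linarith) (by linarith)
          (mul_nonneg (sq_nonneg b) (by linarith)) (sq_nonneg p)
      _ = (p * q) ^ 2 := by ring
  have hup : p * q ≤ a * b * (1 + η) := by
    refine le_of_sq_le_sq ?_ (by positivity)
    calc (p * q) ^ 2 = p ^ 2 * q ^ 2 := by ring
      _ ≤ (a ^ 2 * (1 + η)) * (b ^ 2 * (1 + η)) :=
        mul_le_mul (by linarith) (by linarith) (sq_nonneg q) (by positivity)
      _ = (a * b * (1 + η)) ^ 2 := by ring
  have hpq : 0 < p * q := lt_of_lt_of_le (mul_pos hab (by linarith)) hlow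
  have hd : |a * b - p * q| ≤ η * (a * b) := abs_le.2 ⟨by linarith, by linarith⟩
  have h1 : |a * b * (x - t)| ≤ a * b * (η * (a * b)) := by
    rw [abs_mul, abs_of_pos hab]
    gcongr
  have h2 : |t * (a * b - p * q)| ≤ a * b * (η * (a * b)) := by
    rw [abs_mul]
    exact mul_le_mul ht hd (abs_nonneg _) hab.le
  have he : a * b * x / (p * q) - t = (a * b * (x - t) + t * (a * b - p * q)) / (p * q) := by
    rw [eq_div_iff hpq.ne', sub_mul, div_mul_cancel₀ _ hpq.ne']
    ring
  rw [he, abs_div, abs_of_pos hpq, div_le_iff₀ hpq]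
  calc |a * b * (x - t) + t * (a * b - p * q)|
      ≤ 2 * (a * b) * (η * (a * b)) := by linarith [abs_add_le (a * b * (x - t)) (t * (a * b - p * q))]
    _ ≤ 4 * η * a * b * (a * b * (1 - η)) := by
        have : 0 ≤ η * (a * b) ^ 2 * (1 - 2 * η) :=
          mul_nonneg (by positivity) (by linarith)
        linarith
    _ ≤ 4 * η * a * b * (p * q) := by gcongr

/-- The vectors whose sketched norms control the rescaled estimator: the columns of `A` and `B`,
and the vectors needed for polarization. -/
noncomputable def controlVectors {d n : ℕ} (A B : Matrix (Fin d) (Fin n) ℝ) :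
    (Fin n ⊕ Fin n) ⊕ (Fin n × Fin n) ⊕ (Fin n × Fin n) → Fin d → ℝ :=
  Sum.elim (Sum.elim (fun i r => A r i) (fun j r => B r j))
    (Sum.elim (fun ij r => cnorm B ij.2 * A r ij.1 + cnorm A ij.1 * B r ij.2)
      (fun ij r => cnorm B ij.2 * A r ij.1 + -cnorm A ij.1 * B r ij.2))

lemma abs_sketch_inner_sub_le {k d n : ℕ} {P : Fin k → Fin d → ℝ}
    {A B : Matrix (Fin d) (Fin n) ℝ} {η : ℝ}
    (h : ∀ a, |sketchSq P (controlVectors A B a) - ∑ r, controlVectors A B a r ^ 2| ≤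
      η * ∑ r, controlVectors A B a r ^ 2)
    {i j : Fin n} (ha : 0 < cnorm A i) (hb : 0 < cnorm B j) :
    |((Matrix.of P * A)ᵀ * (Matrix.of P * B)) i j - (Aᵀ * B) i j| ≤
      η * (cnorm A i * cnorm B j) := by
  have h1 := h (.inr (.inl (i, j)))
  have h2 := h (.inr (.inr (i, j)))
  have ht : ∑ r, A r i * B r j = (Aᵀ * B) i j := rfl
  have hx : ∑ l, (∑ r, P l r * A r i) * (∑ r, P l r * B r j) =
      ((Matrix.of P * A)ᵀ * (Matrix.of P * B)) i j := rfl
  simp only [controlVectors, Sum.elim_inr, Sum.elim_inl, sum_sq_linear_combination,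
    sketchSq_linear_combination, ← cnorm_sq, ht, hx] at h1 h2
  have hab : 0 < cnorm A i * cnorm B j := mul_pos ha hb
  rw [abs_le] at h1 h2 ⊢
  constructor <;> refine le_of_mul_le_mul_left ?_ hab <;> linarith

lemma rescaledJL_good {k d n : ℕ} {P : Fin k → Fin d → ℝ} {A B : Matrix (Fin d) (Fin n) ℝ}
    {ε : ℝ} (hε : 0 < ε) (hε2 : ε ≤ 2)
    (hA : ∀ i, (fun r => A r i) ≠ (0 : Fin d → ℝ)) (hB : ∀ j, (fun r => B r j) ≠ (0 : Fin d → ℝ))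
    (h : ∀ a, |sketchSq P (controlVectors A B a) - ∑ r, controlVectors A B a r ^ 2| ≤
      ε / 4 * ∑ r, controlVectors A B a r ^ 2) :
    (∀ i, (fun r => (Matrix.of P * A) r i) ≠ (0 : Fin k → ℝ)) ∧
      (∀ j, (fun r => (Matrix.of P * B) r j) ≠ (0 : Fin k → ℝ)) ∧
      (∀ i j, |rescaledJL P A B i j - (Aᵀ * B) i j| ≤ ε * cnorm A i * cnorm B j) ∧
      frobNorm (rescaledJL P A B - Aᵀ * B) ≤ ε * frobNorm A * frobNorm B := by
  have hAP (i : Fin n) :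
      |cnorm (Matrix.of P * A) i ^ 2 - cnorm A i ^ 2| ≤ ε / 4 * cnorm A i ^ 2 := by
    rw [cnorm_of_mul_sq, cnorm_sq]
    exact h (.inl (.inl i))
  have hBP (j : Fin n) :
      |cnorm (Matrix.of P * B) j ^ 2 - cnorm B j ^ 2| ≤ ε / 4 * cnorm B j ^ 2 := by
    rw [cnorm_of_mul_sq, cnorm_sq]
    exact h (.inl (.inr j))
  have hpos {a p : ℝ} (ha : 0 < a) (hp : 0 ≤ p) (hpa : |p ^ 2 - a ^ 2| ≤ ε / 4 * a ^ 2) :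
      0 < p := by
    refine hp.lt_of_ne' fun h0 => ?_
    rw [h0, abs_le] at hpa
    nlinarith [pow_pos ha 2]
  have hentry (i j : Fin n) :
      |rescaledJL P A B i j - (Aᵀ * B) i j| ≤ ε * cnorm A i * cnorm B j := by
    have ha := cnorm_pos_iff.2 (hA i)
    have hb := cnorm_pos_iff.2 (hB j)
    refine (abs_rescaled_sub_le ha hb (cnorm_nonneg (Matrix.of P * A) i)
      (cnorm_nonneg (Matrix.of P * B) j) (by linarith) (by linarith) (hAP i) (hBP j)
      (abs_sketch_inner_sub_le h ha hb) (abs_transpose_mul_apply_le A B i j)).trans_eq ?_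
    ring
  exact ⟨fun i => cnorm_pos_iff.1 (hpos (cnorm_pos_iff.2 (hA i)) (cnorm_nonneg _ i) (hAP i)),
    fun j => cnorm_pos_iff.1 (hpos (cnorm_pos_iff.2 (hB j)) (cnorm_nonneg _ j) (hBP j)),
    hentry, frobNorm_le_of_entrywise hε.le hentry⟩

lemma union_bound_le {n : ℕ} (hn : 0 < n) {δ s : ℝ} (hδ : 0 < δ) (hδ1 : δ < 1)
    (hs : 3 * Real.log (2 * n / δ) ≤ s) :
    ((n + n : ℝ) + (n * n + n * n)) * (2 * Real.exp (-s)) ≤ δ := by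
  have hn1 : (1 : ℝ) ≤ n := by exact_mod_cast hn
  have hx : (0 : ℝ) < 2 * n / δ := by positivity
  have he : Real.exp (-s) ≤ ((2 * n / δ) ^ 3)⁻¹ := by
    rw [← Real.exp_log hx, ← Real.exp_nat_mul, ← Real.exp_neg, Real.exp_le_exp]
    push_cast
    linarith
  calc ((n + n : ℝ) + (n * n + n * n)) * (2 * Real.exp (-s))
      ≤ (4 * n ^ 2) * (2 * ((2 * n / δ) ^ 3)⁻¹) := by
        gcongr
        nlinarith
    _ = δ ^ 3 / n := by
        field_simp
        norm_num
    _ ≤ δ ^ 3 := div_le_self (by positivity) hn1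
    _ ≤ δ := pow_le_of_le_one hδ.le hδ1.le (by norm_num)

theorem stmt0 :
    ∃ C : ℝ, 0 < C ∧
      ∀ (ε δ : ℝ), 0 < ε → ε < 1 / 14 → 0 < δ → δ < 1 →
      ∀ (d n k : ℕ) (A B : Matrix (Fin d) (Fin n) ℝ),
        (∀ i, (fun r => A r i) ≠ (0 : Fin d → ℝ)) →
        (∀ j, (fun r => B r j) ≠ (0 : Fin d → ℝ)) →
        C * Real.log (2 * n / δ) / ε ^ 2 ≤ k →
        ENNReal.ofReal (1 - δ) ≤
          gaussianMatrix k d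
            {P | (∀ i, (fun r => (Matrix.of P * A) r i) ≠ (0 : Fin k → ℝ)) ∧
                 (∀ j, (fun r => (Matrix.of P * B) r j) ≠ (0 : Fin k → ℝ)) ∧
                 (∀ i j, |rescaledJL P A B i j - (Aᵀ * B) i j| ≤ ε * cnorm A i * cnorm B j) ∧
                 frobNorm (rescaledJL P A B - Aᵀ * B) ≤ ε * frobNorm A * frobNorm B} := by
  refine ⟨768, by norm_num, fun ε δ hε hε1 hδ hδ1 d n k A B hA hB hk => ?_⟩
  set S := {P : Fin k → Fin d → ℝ | (∀ i, (fun r => (Matrix.of P * A) r i) ≠ (0 : Fin k → ℝ)) ∧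
    (∀ j, (fun r => (Matrix.of P * B) r j) ≠ (0 : Fin k → ℝ)) ∧
    (∀ i j, |rescaledJL P A B i j - (Aᵀ * B) i j| ≤ ε * cnorm A i * cnorm B j) ∧
    frobNorm (rescaledJL P A B - Aᵀ * B) ≤ ε * frobNorm A * frobNorm B}
  set bad := {P : Fin k → Fin d → ℝ | ∃ a, ε / 4 * ∑ r, controlVectors A B a r ^ 2 <
    |sketchSq P (controlVectors A B a) - ∑ r, controlVectors A B a r ^ 2|} with hbad
  have hgood : badᶜ ⊆ S := by
    intro P hP
    refine rescaledJL_good hε (by linarith) hA hB fun a => ?_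
    by_contra! ha
    exact hP ⟨a, ha⟩
  have hbadδ : (gaussianMatrix k d).real bad ≤ δ := by
    rcases Nat.eq_zero_or_pos n with rfl | hn
    · simp [hbad, hδ.le]
    have hn1 : (1 : ℝ) ≤ n := by exact_mod_cast hn
    have hlog : 0 < Real.log (2 * n / δ) :=
      Real.log_pos ((one_lt_div hδ).2 (by linarith))
    have hk0 : 0 < k := by
      have : (0 : ℝ) < k := lt_of_lt_of_le (by positivity) hk
      exact_mod_cast this
    refine (gaussianMatrix_exists_deviation_le hk0 (controlVectors A B) (by positivity)
      (by linarith)).trans ?_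
    rw [div_le_iff₀ (by positivity)] at hk
    have := union_bound_le hn hδ hδ1 (s := k * (ε / 4) ^ 2 / 16) (by linarith)
    simpa using this
  have hcover : (1 : ℝ) ≤ (gaussianMatrix k d).real S + (gaussianMatrix k d).real bad := by
    rw [← probReal_univ (μ := gaussianMatrix k d)]
    refine (measureReal_mono fun P _ => ?_).trans (measureReal_union_le S bad)
    exact (em (P ∈ bad)).elim Or.inr fun h => Or.inl (hgood h)
  refine ENNReal.ofReal_le_of_le_toReal ?_
  rw [← measureReal_def]
  linarith
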